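/- Let β > 0, γ ∈ ℝ, d ≥ 1, and fix φ, ξ ∈ ℝ^d with (φ,ξ) ≠ (0,0). There exists a constant C < ∞ depending only on β and γ (in particular not on φ, ξ) such that for every measurable h : ℝ → ℂ with ∫_ℝ W(s,φ,ξ)^{2γ−4β}·|h(s)|² ds < ∞, the following hold: for every t ∈ ℝ the integral (Th)(t) = ∫_{−∞}^t K(t,s,φ,ξ)·h(s) ds converges absolutely; the function t ↦ W(t,φ,ξ)^{γ−β}·(Th)(t) is continuous on ℝ and tends to 0 as t → ±∞; and sup_{t∈ℝ} W(t,φ,ξ)^{γ−β}·|(Th)(t)| ≤ C·(∫_ℝ W(s,φ,ξ)^{2γ−4β}·|h(s)|² ds)^{1/2}. -/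

import Mathlib

open MeasureTheory Real Filter

/-- The weight `W(t,φ,ξ) = max(‖ξ - tφ‖, ‖φ‖^{1/(1+2β)})`. -/
noncomputable def Wgt (β : ℝ) {d : ℕ} (t : ℝ) (φ ξ : EuclideanSpace ℝ (Fin d)) : ℝ :=
  max ‖ξ - t • φ‖ (‖φ‖ ^ (1 / (1 + 2 * β)))

/-- The Kolmogorov kernel `K(t,s,φ,ξ) = exp(-∫_s^t ‖ξ - τφ‖^{2β} dτ)`. -/
noncomputable def Kker (β : ℝ) {d : ℕ} (t s : ℝ) (φ ξ : EuclideanSpace ℝ (Fin d)) : ℝ :=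
  Real.exp (-(∫ τ in s..t, ‖ξ - τ • φ‖ ^ (2 * β)))

/-- The Duhamel integral `(Th)(t) = ∫_{-∞}^t K(t,s) h(s) ds`. -/
noncomputable def Duh (β : ℝ) {d : ℕ} (φ ξ : EuclideanSpace ℝ (Fin d))
    (h : ℝ → ℂ) (t : ℝ) : ℂ :=
  ∫ s in Set.Iic t, (↑(Kker β t s φ ξ) : ℂ) * h s

section Weight

variable {E : Type*} [NormedAddCommGroup E] [InnerProductSpace ℝ E]

lemma rpow_le_exp_mul_rpow {a b L : ℝ} (ha : 0 < a) (hb : 0 < b)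
    (h : |Real.log a - Real.log b| ≤ L) (e : ℝ) :
    a ^ e ≤ Real.exp (|e| * L) * b ^ e := by
  rw [Real.rpow_def_of_pos ha, Real.rpow_def_of_pos hb, ← Real.exp_add, Real.exp_le_exp]
  have h1 : (Real.log a - Real.log b) * e ≤ |e| * L := by
    refine (le_abs_self _).trans ?_
    rw [abs_mul, mul_comm]
    exact mul_le_mul_of_nonneg_left h (abs_nonneg e)
  linarith

/-- A differentiable substitute for the weight `max ‖ξ - tφ‖ m`. -/
noncomputable def smoothWgt (m : ℝ) (φ ξ : E) (t : ℝ) : ℝ := √(‖ξ - t • φ‖ ^ 2 + m ^ 2)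

lemma smoothWgt_continuous (m : ℝ) (φ ξ : E) : Continuous (smoothWgt m φ ξ) := by
  unfold smoothWgt
  fun_prop

lemma norm_le_smoothWgt (m : ℝ) (φ ξ : E) (t : ℝ) : ‖ξ - t • φ‖ ≤ smoothWgt m φ ξ t :=
  Real.le_sqrt_of_sq_le (by nlinarith [sq_nonneg m])

lemma le_smoothWgt (m : ℝ) (φ ξ : E) (t : ℝ) : m ≤ smoothWgt m φ ξ t :=
  Real.le_sqrt_of_sq_le (by nlinarith [sq_nonneg ‖ξ - t • φ‖])

lemma smoothWgt_le {m : ℝ} (hm : 0 ≤ m) (φ ξ : E) (t : ℝ) :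
    smoothWgt m φ ξ t ≤ √2 * max ‖ξ - t • φ‖ m := by
  have h0 : 0 ≤ max ‖ξ - t • φ‖ m := le_max_of_le_right hm
  refine Real.sqrt_le_iff.2 ⟨by positivity, ?_⟩
  rw [mul_pow, Real.sq_sqrt (by norm_num)]
  have h1 := pow_le_pow_left₀ (norm_nonneg _) (le_max_left ‖ξ - t • φ‖ m) 2
  have h2 := pow_le_pow_left₀ hm (le_max_right ‖ξ - t • φ‖ m) 2
  linarith

lemma exists_hasDerivAt_log_smoothWgt {m : ℝ} {φ ξ : E} {t : ℝ} (hv : 0 < smoothWgt m φ ξ t) :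
    ∃ l, HasDerivAt (fun t => Real.log (smoothWgt m φ ξ t)) l t ∧
      |l| * smoothWgt m φ ξ t ≤ ‖φ‖ := by
  have hq : 0 < ‖ξ - t • φ‖ ^ 2 + m ^ 2 := Real.sqrt_pos.1 hv
  have h1 : HasDerivAt (fun t : ℝ => ξ - t • φ) (-φ) t := by
    simpa using ((hasDerivAt_id t).smul_const φ).const_sub ξ
  have h2 := ((h1.norm_sq.add_const (m ^ 2)).sqrt hq.ne').log hv.ne'
  refine ⟨_, h2, ?_⟩
  have h3 : |inner ℝ (ξ - t • φ) (-φ)| ≤ smoothWgt m φ ξ t * ‖φ‖ := by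
    refine (abs_real_inner_le_norm _ _).trans ?_
    rw [norm_neg]
    exact mul_le_mul_of_nonneg_right (norm_le_smoothWgt m φ ξ t) (norm_nonneg _)
  change |2 * inner ℝ (ξ - t • φ) (-φ) / (2 * smoothWgt m φ ξ t) / smoothWgt m φ ξ t| *
    smoothWgt m φ ξ t ≤ ‖φ‖
  rw [abs_div, abs_div, abs_mul, abs_mul, abs_of_pos hv, abs_of_pos (zero_lt_two' ℝ),
    div_mul_cancel₀ _ hv.ne', div_le_iff₀ (by positivity)]
  linarith

lemma abs_log_smoothWgt_sub_le {β m lam : ℝ} {φ ξ : E} {U : ℝ → ℝ} (hlam : 0 < lam)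
    (hβ : 0 < β) (hm : 0 ≤ m) (hφ : lam * ‖φ‖ ≤ m ^ (1 + 2 * β))
    (hv : ∀ t, 0 < smoothWgt m φ ξ t)
    (hU : ∀ t, HasDerivAt U (smoothWgt m φ ξ t ^ (2 * β)) t) {s t : ℝ} (hst : s ≤ t) :
    |Real.log (smoothWgt m φ ξ t) - Real.log (smoothWgt m φ ξ s)| ≤ (U t - U s) / lam := by
  choose l hl hl' using fun t => exists_hasDerivAt_log_smoothWgt (hv t)
  have hb : ∀ t, |l t| ≤ smoothWgt m φ ξ t ^ (2 * β) / lam := by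
    intro t
    rw [le_div_iff₀ hlam]
    have h1 : lam * ‖φ‖ ≤ smoothWgt m φ ξ t * smoothWgt m φ ξ t ^ (2 * β) := by
      rw [← Real.rpow_one_add' (hv t).le (by positivity)]
      exact hφ.trans (Real.rpow_le_rpow hm (le_smoothWgt m φ ξ t) (by positivity))
    refine le_of_mul_le_mul_left ?_ (hv t)
    calc smoothWgt m φ ξ t * (|l t| * lam) = lam * (|l t| * smoothWgt m φ ξ t) := by ring
      _ ≤ lam * ‖φ‖ := mul_le_mul_of_nonneg_left (hl' t) hlam.le
      _ ≤ _ := h1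
  have m1 := monotone_of_hasDerivAt_nonneg (fun t => ((hU t).div_const lam).sub (hl t))
    (fun t => sub_nonneg.2 ((le_abs_self _).trans (hb t))) hst
  have m2 := monotone_of_hasDerivAt_nonneg (fun t => ((hU t).div_const lam).add (hl t))
    (fun t => by
      have := (neg_le_abs (l t)).trans (hb t)
      simp only [Pi.zero_apply]
      linarith) hst
  simp only [Pi.sub_apply, Pi.add_apply] at m1 m2
  rw [abs_le, sub_div]
  constructor <;> linarith

lemma volume_norm_lt_le {m : ℝ} {φ : E} (hφ : φ ≠ 0) (ξ : E) :
    volume {τ : ℝ | ‖ξ - τ • φ‖ < m} ≤ ENNReal.ofReal (2 * m / ‖φ‖) := by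
  refine (Real.volume_le_diam _).trans (Metric.ediam_le fun x hx y hy => ?_)
  rw [edist_dist]
  refine ENNReal.ofReal_le_ofReal ?_
  rw [le_div_iff₀ (norm_pos_iff.2 hφ), Real.dist_eq, ← Real.norm_eq_abs, ← norm_smul]
  have : (x - y) • φ = (ξ - y • φ) - (ξ - x • φ) := by rw [sub_smul]; abel
  rw [this]
  refine (norm_sub_le _ _).trans ?_
  simp only [Set.mem_ofPred_eq] at hx hy
  linarith

lemma integral_smoothWgt_rpow_le {β m lam : ℝ} {φ ξ : E} (hlam : 0 < lam) (hβ : 0 < β)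
    (hm : m = (lam * ‖φ‖) ^ (1 / (1 + 2 * β))) {s t : ℝ} (hst : s ≤ t) :
    2⁻¹ ^ β * ∫ τ in s..t, smoothWgt m φ ξ τ ^ (2 * β) ≤
      (∫ τ in s..t, ‖ξ - τ • φ‖ ^ (2 * β)) + 2 * lam := by
  have hm0 : 0 ≤ m := by rw [hm]; positivity
  set S : Set ℝ := {τ : ℝ | ‖ξ - τ • φ‖ < m} with hS
  have hSm : MeasurableSet S :=
    (isOpen_lt (by fun_prop) continuous_const).measurableSet
  have hvi : Continuous fun τ => smoothWgt m φ ξ τ ^ (2 * β) :=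
    (smoothWgt_continuous m φ ξ).rpow_const fun _ => Or.inr (by positivity)
  have hpi : Continuous fun τ : ℝ => ‖ξ - τ • φ‖ ^ (2 * β) :=
    (by fun_prop : Continuous fun τ : ℝ => ‖ξ - τ • φ‖).rpow_const fun _ => Or.inr (by positivity)
  have hind : IntervalIntegrable (S.indicator fun _ => m ^ (2 * β)) volume s t := by
    rw [intervalIntegrable_iff_integrableOn_Ioc_of_le hst]
    exact (integrableOn_const (by simp)).indicator hSm
  have hpt : ∀ τ, 2⁻¹ ^ β * smoothWgt m φ ξ τ ^ (2 * β) ≤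
      ‖ξ - τ • φ‖ ^ (2 * β) + S.indicator (fun _ => m ^ (2 * β)) τ := by
    intro τ
    have h0 : 0 ≤ max ‖ξ - τ • φ‖ m := le_max_of_le_right hm0
    have h1 : 2⁻¹ ^ β * smoothWgt m φ ξ τ ^ (2 * β) ≤ max ‖ξ - τ • φ‖ m ^ (2 * β) := by
      have h2 := Real.rpow_le_rpow (Real.sqrt_nonneg _) (smoothWgt_le hm0 φ ξ τ)
        (by positivity : 0 ≤ 2 * β)
      rw [Real.mul_rpow (by positivity) h0, Real.rpow_mul (by positivity : 0 ≤ √2),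
        Real.rpow_two, Real.sq_sqrt (by norm_num)] at h2
      rw [Real.inv_rpow (by norm_num), inv_mul_le_iff₀ (by positivity)]
      exact h2
    refine h1.trans ?_
    by_cases hτ : τ ∈ S
    · rw [Set.indicator_of_mem hτ, max_eq_right (le_of_lt hτ)]
      linarith [Real.rpow_nonneg (norm_nonneg (ξ - τ • φ)) (2 * β)]
    · rw [Set.indicator_of_notMem hτ, max_eq_left (not_lt.1 hτ), add_zero]
  have hI : ∫ τ in s..t, S.indicator (fun _ => m ^ (2 * β)) τ ≤ 2 * lam := by
    rw [intervalIntegral.integral_of_le hst, integral_indicator hSm, setIntegral_const,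
      measureReal_restrict_apply hSm, smul_eq_mul]
    rcases eq_or_ne φ 0 with h0 | h0
    · have : m = 0 := by
        rw [hm, h0, norm_zero, mul_zero, Real.zero_rpow (by positivity)]
      rw [this, Real.zero_rpow (by positivity), mul_zero]
      positivity
    · have hφ : 0 < ‖φ‖ := norm_pos_iff.2 h0
      have hle : volume.real (S ∩ Set.Ioc s t) ≤ 2 * m / ‖φ‖ := by
        refine ENNReal.toReal_le_of_le_ofReal (by positivity) ?_
        exact (measure_mono Set.inter_subset_left).trans (volume_norm_lt_le h0 ξ)
      refine (mul_le_mul_of_nonneg_right hle (by positivity)).trans (le_of_eq ?_)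
      have h1 : m * m ^ (2 * β) = lam * ‖φ‖ := by
        rw [← Real.rpow_one_add' hm0 (by positivity), hm, ← Real.rpow_mul (by positivity),
          one_div_mul_cancel (by positivity), Real.rpow_one]
      field_simp
      linarith
  rw [← intervalIntegral.integral_const_mul]
  refine (intervalIntegral.integral_mono_on hst ((hvi.intervalIntegrable s t).const_mul _)
    ((hpi.intervalIntegrable s t).add hind) fun τ _ => hpt τ).trans ?_
  rw [intervalIntegral.integral_add (hpi.intervalIntegrable s t) hind]
  linarith

end Weight

lemma Wgt_pos {β : ℝ} {d : ℕ} {φ ξ : EuclideanSpace ℝ (Fin d)} (h : (φ, ξ) ≠ (0, 0)) (t : ℝ) :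
    0 < Wgt β t φ ξ := by
  rcases eq_or_ne φ 0 with h0 | h0
  · have : ξ ≠ 0 := by rintro rfl; exact h (by rw [h0])
    refine lt_max_of_lt_left ?_
    simpa [h0] using this
  · exact lt_max_of_lt_right (Real.rpow_pos_of_pos (norm_pos_iff.2 h0) _)

lemma Wgt_continuous (β : ℝ) {d : ℕ} (φ ξ : EuclideanSpace ℝ (Fin d)) :
    Continuous fun t => Wgt β t φ ξ := by
  unfold Wgt
  fun_prop

lemma exists_weighted_Kker_bound (β γ : ℝ) (hβ : 0 < β) :
    ∃ c > 0, ∃ C > 0, ∀ (d : ℕ) (φ ξ : EuclideanSpace ℝ (Fin d)), (φ, ξ) ≠ (0, 0) →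
      ∃ u U : ℝ → ℝ, ∃ b > 0, Continuous u ∧ (∀ s, b ≤ u s) ∧ (∀ s, HasDerivAt U (u s) s) ∧
        ∀ s t, s ≤ t → Wgt β t φ ξ ^ (γ - β) * Kker β t s φ ξ ≤
          C * (Real.exp (c * (U s - U t)) * √(u s)) * Wgt β s φ ξ ^ (γ - 2 * β) := by
  set k : ℝ := 2⁻¹ ^ β with hk
  have hk0 : 0 < k := by positivity
  set lam : ℝ := 2 * |γ - β| / k + 1 with hlam
  have hlam1 : 1 ≤ lam := by
    have : 0 ≤ 2 * |γ - β| / k := by positivity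
    linarith
  have hlam0 : 0 < lam := by linarith
  have hratio : |γ - β| / lam ≤ k / 2 := by
    rw [div_le_div_iff₀ hlam0 two_pos]
    have : k * lam = 2 * |γ - β| + k := by rw [hlam]; field_simp
    linarith
  set κ : ℝ := 1 / (1 + 2 * β) with hκ
  have hκ0 : 0 < κ := by positivity
  set D : ℝ := √2 * lam ^ κ with hD
  have hlamκ : 1 ≤ lam ^ κ := Real.one_le_rpow hlam1 hκ0.le
  refine ⟨k / 2, by positivity, Real.exp (|γ - β| * Real.log D) *
    Real.exp (|γ - 2 * β| * Real.log D) * Real.exp (2 * lam), by positivity, ?_⟩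
  intro d φ ξ hne
  set m : ℝ := (lam * ‖φ‖) ^ κ with hm
  have hm0 : 0 ≤ m := by positivity
  have hmmul : m = lam ^ κ * ‖φ‖ ^ κ := Real.mul_rpow hlam0.le (norm_nonneg _)
  set v := smoothWgt m φ ξ with hv
  have hw0 := fun t => Wgt_pos (β := β) hne t
  have hwv : ∀ t, Wgt β t φ ξ ≤ v t := fun t =>
    max_le (norm_le_smoothWgt m φ ξ t) (le_trans (by
      rw [hmmul]
      exact le_mul_of_one_le_left (by positivity) hlamκ) (le_smoothWgt m φ ξ t))
  have hv0 : ∀ t, 0 < v t := fun t => (hw0 t).trans_le (hwv t)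
  have hvw : ∀ t, v t ≤ D * Wgt β t φ ξ := by
    intro t
    refine (smoothWgt_le hm0 φ ξ t).trans ?_
    rw [hD, mul_assoc]
    refine mul_le_mul_of_nonneg_left (max_le ?_ ?_) (by positivity)
    · exact (le_max_left _ _).trans (le_mul_of_one_le_left (hw0 t).le hlamκ)
    · rw [hmmul]
      exact mul_le_mul_of_nonneg_left (le_max_right _ _) (by positivity)
  have hlog : ∀ t, |Real.log (Wgt β t φ ξ) - Real.log (v t)| ≤ Real.log D := by
    intro t
    have h1 := Real.log_le_log (hw0 t) (hwv t)
    have h2 := Real.log_le_log (hv0 t) (hvw t)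
    rw [Real.log_mul (by positivity) (hw0 t).ne'] at h2
    rw [abs_sub_comm, abs_of_nonneg (by linarith)]
    linarith
  have hu : Continuous fun τ => v τ ^ (2 * β) :=
    (smoothWgt_continuous m φ ξ).rpow_const fun _ => Or.inr (by positivity)
  have hU : ∀ s, HasDerivAt (fun s => ∫ τ in (0 : ℝ)..s, v τ ^ (2 * β)) (v s ^ (2 * β)) s :=
    fun s => intervalIntegral.integral_hasDerivAt_right (hu.intervalIntegrable _ _)
      (hu.stronglyMeasurableAtFilter _ _) hu.continuousAt
  have hlow : ∃ v₀ > 0, ∀ s, v₀ ≤ v s := by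
    rcases eq_or_ne φ 0 with h0 | h0
    · have : ξ ≠ 0 := by rintro rfl; exact hne (by rw [h0])
      refine ⟨‖ξ‖, norm_pos_iff.2 this, fun s => ?_⟩
      calc ‖ξ‖ = ‖ξ - s • φ‖ := by rw [h0, smul_zero, sub_zero]
        _ ≤ v s := norm_le_smoothWgt m φ ξ s
    · exact ⟨m, Real.rpow_pos_of_pos (mul_pos hlam0 (norm_pos_iff.2 h0)) _,
        le_smoothWgt m φ ξ⟩
  obtain ⟨v₀, hv₀, hv₀v⟩ := hlow
  refine ⟨fun τ => v τ ^ (2 * β), fun s => ∫ τ in (0 : ℝ)..s, v τ ^ (2 * β), v₀ ^ (2 * β),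
    by positivity, hu, fun s => Real.rpow_le_rpow hv₀.le (hv₀v s) (by positivity), hU, ?_⟩
  intro s t hst
  set U := fun s => ∫ τ in (0 : ℝ)..s, v τ ^ (2 * β) with hUdef
  have hsub : U t - U s = ∫ τ in s..t, v τ ^ (2 * β) :=
    intervalIntegral.integral_interval_sub_left (hu.intervalIntegrable _ _)
      (hu.intervalIntegrable _ _)
  have hΔ : 0 ≤ U t - U s := by
    rw [hsub]
    exact intervalIntegral.integral_nonneg hst fun τ _ => by have := hv0 τ; positivity
  have hK : Kker β t s φ ξ ≤ Real.exp (2 * lam) * Real.exp (-(k * (U t - U s))) := by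
    rw [Kker, ← Real.exp_add, Real.exp_le_exp, hsub]
    have := integral_smoothWgt_rpow_le (ξ := ξ) hlam0 hβ hm hst
    rw [← hk, ← hv] at this
    linarith
  have h1 : Wgt β t φ ξ ^ (γ - β) ≤ Real.exp (|γ - β| * Real.log D) * v t ^ (γ - β) :=
    rpow_le_exp_mul_rpow (hw0 t) (hv0 t) (hlog t) _
  have h2 : v t ^ (γ - β) ≤ Real.exp (k / 2 * (U t - U s)) * v s ^ (γ - β) := by
    have hφ : lam * ‖φ‖ ≤ m ^ (1 + 2 * β) := by
      rw [hm, ← Real.rpow_mul (by positivity), hκ, one_div_mul_cancel (by positivity),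
        Real.rpow_one]
    refine (rpow_le_exp_mul_rpow (hv0 t) (hv0 s)
      (abs_log_smoothWgt_sub_le hlam0 hβ hm0 hφ hv0 hU hst) _).trans ?_
    refine mul_le_mul_of_nonneg_right (Real.exp_le_exp.2 ?_) (Real.rpow_nonneg (hv0 s).le _)
    calc |γ - β| * ((U t - U s) / lam) = |γ - β| / lam * (U t - U s) := by ring
      _ ≤ _ := mul_le_mul_of_nonneg_right hratio hΔ
  have h3 : v s ^ (γ - 2 * β) ≤
      Real.exp (|γ - 2 * β| * Real.log D) * Wgt β s φ ξ ^ (γ - 2 * β) :=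
    rpow_le_exp_mul_rpow (hv0 s) (hw0 s) (by rw [abs_sub_comm]; exact hlog s) _
  have h4 : v s ^ (γ - β) = √(v s ^ (2 * β)) * v s ^ (γ - 2 * β) := by
    rw [Real.sqrt_eq_rpow, ← Real.rpow_mul (hv0 s).le, ← Real.rpow_add (hv0 s)]
    congr 1
    ring
  have hexp : Real.exp (k / 2 * (U t - U s)) * Real.exp (-(k * (U t - U s))) =
      Real.exp (k / 2 * (U s - U t)) := by
    rw [← Real.exp_add]
    congr 1
    ring
  have hvt : 0 ≤ v t ^ (γ - β) := Real.rpow_nonneg (hv0 t).le _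
  have hvs : 0 ≤ v s ^ (γ - β) := Real.rpow_nonneg (hv0 s).le _
  have hK0 : 0 ≤ Kker β t s φ ξ := (Real.exp_pos _).le
  set A := Real.exp (|γ - β| * Real.log D)
  set B := Real.exp (|γ - 2 * β| * Real.log D)
  set L := Real.exp (2 * lam)
  calc Wgt β t φ ξ ^ (γ - β) * Kker β t s φ ξ
      ≤ (A * (Real.exp (k / 2 * (U t - U s)) * v s ^ (γ - β))) *
        (L * Real.exp (-(k * (U t - U s)))) := by
        refine mul_le_mul (h1.trans ?_) hK hK0 (by positivity)
        exact mul_le_mul_of_nonneg_left h2 (Real.exp_pos _).le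
    _ = A * L * (Real.exp (k / 2 * (U t - U s)) * Real.exp (-(k * (U t - U s)))) *
        √(v s ^ (2 * β)) * v s ^ (γ - 2 * β) := by rw [h4]; ring
    _ ≤ A * L * (Real.exp (k / 2 * (U t - U s)) * Real.exp (-(k * (U t - U s)))) *
        √(v s ^ (2 * β)) * (B * Wgt β s φ ξ ^ (γ - 2 * β)) :=
        mul_le_mul_of_nonneg_left h3 (by positivity)
    _ = _ := by rw [hexp]; ring

lemma integrableOn_exp_mul_deriv {u U : ℝ → ℝ} {c : ℝ} (hc : 0 < c) (hu : Continuous u)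
    (hu0 : ∀ s, 0 ≤ u s) (hU : ∀ s, HasDerivAt U (u s) s) (t : ℝ) :
    IntegrableOn (fun s => Real.exp (c * (U s - U t)) * u s) (Set.Iic t) ∧
      ∫ s in Set.Iic t, Real.exp (c * (U s - U t)) * u s ≤ 1 / c := by
  have hUc : Continuous U := continuous_iff_continuousAt.2 fun s => (hU s).continuousAt
  have hf : Continuous fun s => Real.exp (c * (U s - U t)) * u s := by fun_prop
  have hd : ∀ s, HasDerivAt (fun s => Real.exp (c * (U s - U t)) / c)
      (Real.exp (c * (U s - U t)) * u s) s := by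
    intro s
    refine ((((hU s).sub_const (U t)).const_mul c).exp.div_const c).congr_deriv ?_
    field_simp
  have hle : ∀ a, ∫ s in a..t, Real.exp (c * (U s - U t)) * u s ≤ 1 / c := by
    intro a
    rw [intervalIntegral.integral_eq_sub_of_hasDerivAt (fun s _ => hd s)
      (hf.intervalIntegrable _ _), sub_self, mul_zero, Real.exp_zero]
    have : 0 ≤ Real.exp (c * (U a - U t)) / c := by positivity
    linarith
  have hi : IntegrableOn (fun s => Real.exp (c * (U s - U t)) * u s) (Set.Iic t) := by
    refine integrableOn_Iic_of_intervalIntegral_norm_bounded (a := id) (l := atBot) (1 / c) t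
      (fun a => hf.integrableOn_Ioc) tendsto_id (Eventually.of_forall fun a => ?_)
    refine le_trans (le_of_eq ?_) (hle a)
    refine intervalIntegral.integral_congr fun s _ => ?_
    exact Real.norm_of_nonneg (mul_nonneg (Real.exp_pos _).le (hu0 s))
  exact ⟨hi, le_of_tendsto (intervalIntegral_tendsto_integral_Iic t hi tendsto_id)
    (Eventually.of_forall hle)⟩

lemma integral_mul_le_sqrt_mul_sqrt {α : Type*} [MeasurableSpace α] {μ : Measure α} {f g : α → ℝ}
    (hf0 : ∀ x, 0 ≤ f x) (hg0 : ∀ x, 0 ≤ g x) (hf : MemLp f 2 μ) (hg : MemLp g 2 μ) :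
    ∫ x, f x * g x ∂μ ≤ √(∫ x, f x ^ 2 ∂μ) * √(∫ x, g x ^ 2 ∂μ) := by
  have := integral_mul_le_Lp_mul_Lq_of_nonneg (μ := μ) Real.HolderConjugate.two_two
    (Eventually.of_forall hf0) (Eventually.of_forall hg0) (by simpa using hf) (by simpa using hg)
  simpa only [Real.sqrt_eq_rpow, Real.rpow_two] using this

lemma integrableOn_mul_norm_of_le {u U k ρ : ℝ → ℝ} {h : ℝ → ℂ} {c C t : ℝ} (hc : 0 < c)
    (hC : 0 ≤ C) (hu : Continuous u) (hu0 : ∀ s, 0 ≤ u s) (hU : ∀ s, HasDerivAt U (u s) s)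
    (hk : Measurable k) (hk0 : ∀ s, 0 ≤ k s) (hρ : Measurable ρ) (hρ0 : ∀ s, 0 ≤ ρ s)
    (hh : Measurable h) (hint : Integrable fun s => (ρ s * ‖h s‖) ^ 2)
    (hle : ∀ s ≤ t, k s ≤ C * (Real.exp (c * (U s - U t)) * √(u s)) * ρ s) :
    IntegrableOn (fun s => k s * ‖h s‖) (Set.Iic t) ∧
      ∫ s in Set.Iic t, k s * ‖h s‖ ≤
        C * √(1 / (2 * c)) * √(∫ s in Set.Iic t, (ρ s * ‖h s‖) ^ 2) := by
  have hUc : Continuous U := continuous_iff_continuousAt.2 fun s => (hU s).continuousAt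
  set a : ℝ → ℝ := fun s => Real.exp (c * (U s - U t)) * √(u s) with ha
  have hac : Continuous a := by fun_prop
  have ha2 : (fun s => a s ^ 2) = fun s => Real.exp (2 * c * (U s - U t)) * u s := by
    funext s
    rw [ha, mul_pow, Real.sq_sqrt (hu0 s), ← Real.exp_nat_mul]
    congr 2
    push_cast
    ring
  obtain ⟨hi1, hi2⟩ := integrableOn_exp_mul_deriv (c := 2 * c) (by positivity) hu hu0 hU t
  have haL : MemLp a 2 (volume.restrict (Set.Iic t)) := by
    rw [memLp_two_iff_integrable_sq hac.aestronglyMeasurable, ha2]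
    exact hi1
  have hgL : MemLp (fun s => ρ s * ‖h s‖) 2 (volume.restrict (Set.Iic t)) := by
    exact (memLp_two_iff_integrable_sq (hρ.mul hh.norm).aestronglyMeasurable).2
      hint.integrableOn
  have hprod : IntegrableOn (fun s => C * (a s * (ρ s * ‖h s‖))) (Set.Iic t) :=
    (haL.integrable_mul hgL).const_mul C
  have hpt : ∀ s ≤ t, k s * ‖h s‖ ≤ C * (a s * (ρ s * ‖h s‖)) := by
    intro s hs
    calc k s * ‖h s‖ ≤ C * a s * ρ s * ‖h s‖ :=
          mul_le_mul_of_nonneg_right (hle s hs) (norm_nonneg _)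
      _ = _ := by ring
  have hki : IntegrableOn (fun s => k s * ‖h s‖) (Set.Iic t) := by
    refine Integrable.mono' hprod (hk.mul hh.norm).aestronglyMeasurable ?_
    refine (ae_restrict_iff' measurableSet_Iic).2 (Eventually.of_forall fun s hs => ?_)
    rw [Real.norm_of_nonneg (mul_nonneg (hk0 s) (norm_nonneg _))]
    exact hpt s hs
  refine ⟨hki, (setIntegral_mono_on hki hprod measurableSet_Iic hpt).trans ?_⟩
  rw [integral_const_mul, mul_assoc]
  refine mul_le_mul_of_nonneg_left ((integral_mul_le_sqrt_mul_sqrt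
    (fun s => by positivity) (fun s => mul_nonneg (hρ0 s) (norm_nonneg _)) haL hgL).trans ?_) hC
  refine mul_le_mul_of_nonneg_right (Real.sqrt_le_sqrt ?_) (Real.sqrt_nonneg _)
  rw [ha2]
  exact hi2

section Kernel

variable {β : ℝ} {d : ℕ} {φ ξ : EuclideanSpace ℝ (Fin d)}

lemma continuous_norm_sub_smul_rpow (hβ : 0 < β) (φ ξ : EuclideanSpace ℝ (Fin d)) :
    Continuous fun τ : ℝ => ‖ξ - τ • φ‖ ^ (2 * β) :=
  (by fun_prop : Continuous fun τ : ℝ => ‖ξ - τ • φ‖).rpow_const fun _ => Or.inr (by positivity)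

lemma Kker_mul_Kker (hβ : 0 < β) (φ ξ : EuclideanSpace ℝ (Fin d)) (t r s : ℝ) :
    Kker β t r φ ξ * Kker β r s φ ξ = Kker β t s φ ξ := by
  have hc := continuous_norm_sub_smul_rpow hβ φ ξ
  rw [Kker, Kker, Kker, ← Real.exp_add, ← intervalIntegral.integral_add_adjacent_intervals
    (hc.intervalIntegrable s r) (hc.intervalIntegrable r t)]
  congr 1
  ring

lemma Kker_pos (β t s : ℝ) (φ ξ : EuclideanSpace ℝ (Fin d)) : 0 < Kker β t s φ ξ :=
  Real.exp_pos _

lemma Kker_continuous_left (hβ : 0 < β) (s : ℝ) (φ ξ : EuclideanSpace ℝ (Fin d)) :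
    Continuous fun t => Kker β t s φ ξ :=
  (intervalIntegral.continuous_primitive
    (fun a b => (continuous_norm_sub_smul_rpow hβ φ ξ).intervalIntegrable a b) s).neg.rexp

lemma Kker_continuous_right (hβ : 0 < β) (t : ℝ) (φ ξ : EuclideanSpace ℝ (Fin d)) :
    Continuous fun s => Kker β t s φ ξ := by
  have : (fun s => Kker β t s φ ξ) = fun s => (Kker β s t φ ξ)⁻¹ := by
    funext s
    refine eq_inv_of_mul_eq_one_left ?_
    rw [Kker_mul_Kker hβ, Kker, intervalIntegral.integral_same, neg_zero, Real.exp_zero]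
  rw [this]
  exact (Kker_continuous_left hβ t φ ξ).inv₀ fun s => (Kker_pos β s t φ ξ).ne'

lemma Duh_eq_Kker_mul (hβ : 0 < β) (φ ξ : EuclideanSpace ℝ (Fin d)) (h : ℝ → ℂ) (t r : ℝ) :
    Duh β φ ξ h t =
      (Kker β t r φ ξ : ℂ) * ∫ s in Set.Iic t, (Kker β r s φ ξ : ℂ) * h s := by
  rw [Duh, ← integral_const_mul]
  refine integral_congr_ae (Eventually.of_forall fun s => ?_)
  simp only
  rw [← mul_assoc, ← Complex.ofReal_mul, Kker_mul_Kker hβ]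

lemma integrableOn_Kker_mul (hβ : 0 < β) {h : ℝ → ℂ}
    (hi : ∀ t : ℝ, IntegrableOn (fun s => (Kker β t s φ ξ : ℂ) * h s) (Set.Iic t)) (r t : ℝ) :
    IntegrableOn (fun s => (Kker β r s φ ξ : ℂ) * h s) (Set.Iic t) := by
  refine ((hi t).const_mul (Kker β r t φ ξ : ℂ)).congr (Eventually.of_forall fun s => ?_)
  simp only
  rw [← mul_assoc, ← Complex.ofReal_mul, Kker_mul_Kker hβ]

lemma Duh_continuous (hβ : 0 < β) {h : ℝ → ℂ}
    (hi : ∀ t : ℝ, IntegrableOn (fun s => (Kker β t s φ ξ : ℂ) * h s) (Set.Iic t)) :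
    Continuous (Duh β φ ξ h) := by
  have hi0 := integrableOn_Kker_mul hβ hi 0
  have hJ : Continuous fun t => ∫ s in Set.Iic t, (Kker β 0 s φ ξ : ℂ) * h s := by
    have : (fun t => ∫ s in Set.Iic t, (Kker β 0 s φ ξ : ℂ) * h s) = fun t =>
        (∫ s in (0 : ℝ)..t, (Kker β 0 s φ ξ : ℂ) * h s) +
          ∫ s in Set.Iic 0, (Kker β 0 s φ ξ : ℂ) * h s := by
      funext t
      rw [← intervalIntegral.integral_Iic_sub_Iic (hi0 0) (hi0 t), sub_add_cancel]
    rw [this]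
    refine (intervalIntegral.continuous_primitive (fun a b => ?_) 0).add continuous_const
    exact ⟨(hi0 b).mono_set Set.Ioc_subset_Iic_self, (hi0 a).mono_set Set.Ioc_subset_Iic_self⟩
  have : Duh β φ ξ h = fun t =>
      (Kker β t 0 φ ξ : ℂ) * ∫ s in Set.Iic t, (Kker β 0 s φ ξ : ℂ) * h s :=
    funext fun t => Duh_eq_Kker_mul hβ φ ξ h t 0
  rw [this]
  exact (Complex.continuous_ofReal.comp (Kker_continuous_left hβ 0 φ ξ)).mul hJ

lemma Duh_eq_add_indicator (hβ : 0 < β) {h : ℝ → ℂ}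
    (hi : ∀ t : ℝ, IntegrableOn (fun s => (Kker β t s φ ξ : ℂ) * h s) (Set.Iic t))
    {r t : ℝ} (hrt : r ≤ t) :
    Duh β φ ξ h t = (Kker β t r φ ξ : ℂ) * Duh β φ ξ h r +
      Duh β φ ξ ((Set.Ioi r).indicator h) t := by
  have h1 : (Kker β t r φ ξ : ℂ) * Duh β φ ξ h r =
      ∫ s in Set.Iic r, (Kker β t s φ ξ : ℂ) * h s := by
    rw [Duh, ← integral_const_mul]
    refine integral_congr_ae (Eventually.of_forall fun s => ?_)
    simp only
    rw [← mul_assoc, ← Complex.ofReal_mul, Kker_mul_Kker hβ]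
  have h2 : Duh β φ ξ ((Set.Ioi r).indicator h) t =
      ∫ s in Set.Ioc r t, (Kker β t s φ ξ : ℂ) * h s := by
    rw [← Set.Ioi_inter_Iic, Set.inter_comm, ← setIntegral_indicator measurableSet_Ioi, Duh]
    refine integral_congr_ae (Eventually.of_forall fun s => ?_)
    simp only [Set.indicator_apply]
    split_ifs <;> simp
  rw [h1, h2, Duh, ← setIntegral_union (Set.Iic_disjoint_Ioc le_rfl) measurableSet_Ioc
    ((hi t).mono_set (Set.Iic_subset_Iic.2 hrt)) ((hi t).mono_set Set.Ioc_subset_Iic_self),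
    Set.Iic_union_Ioc_eq_Iic hrt]

lemma tendsto_Wgt_rpow_mul_Kker (γ : ℝ) (hβ : 0 < β) (hne : (φ, ξ) ≠ (0, 0)) (r : ℝ) :
    Tendsto (fun t => Wgt β t φ ξ ^ (γ - β) * Kker β t r φ ξ) atTop (nhds 0) := by
  obtain ⟨c, hc, C, hC, H⟩ := exists_weighted_Kker_bound β γ hβ
  obtain ⟨u, U, b, hb, hu, hbu, hU, hK⟩ := H d φ ξ hne
  have hUb : ∀ t, r ≤ t → b * (t - r) ≤ U t - U r := by
    intro t ht
    have := monotone_of_hasDerivAt_nonneg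
      (fun s => (hU s).sub ((hasDerivAt_id s).const_mul b))
      (fun s => by simpa using hbu s) ht
    simp only [Pi.sub_apply, id] at this
    linarith
  have hexp : Tendsto (fun t => Real.exp (c * (U r - U t))) atTop (nhds 0) := by
    refine Real.tendsto_exp_atBot.comp ?_
    refine tendsto_atBot_mono' atTop (f₁ := fun t => -(c * b * (t - r))) ?_ ?_
    · filter_upwards [eventually_ge_atTop r] with t ht
      have := mul_le_mul_of_nonneg_left (hUb t ht) hc.le
      linarith
    · exact tendsto_neg_atTop_atBot.comp
        ((tendsto_atTop_add_const_right _ (-r) tendsto_id).const_mul_atTop (by positivity))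
  have hlim : Tendsto (fun t => C * (Real.exp (c * (U r - U t)) * √(u r)) *
      Wgt β r φ ξ ^ (γ - 2 * β)) atTop (nhds 0) := by
    simpa using ((hexp.mul_const (√(u r))).const_mul C).mul_const (Wgt β r φ ξ ^ (γ - 2 * β))
  refine squeeze_zero' (Eventually.of_forall fun t => ?_) ?_ hlim
  · exact mul_nonneg (Real.rpow_nonneg (Wgt_pos hne t).le _) (Kker_pos β t r φ ξ).le
  · filter_upwards [eventually_ge_atTop r] with t ht using hK r t ht

end Kernel

lemma exists_weighted_Duh_bound (β γ : ℝ) (hβ : 0 < β) :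
    ∃ C ≥ 0, ∀ (d : ℕ) (φ ξ : EuclideanSpace ℝ (Fin d)), (φ, ξ) ≠ (0, 0) →
      ∀ h : ℝ → ℂ, Measurable h →
        Integrable (fun s : ℝ => Wgt β s φ ξ ^ (2 * γ - 4 * β) * ‖h s‖ ^ 2) → ∀ t : ℝ,
          IntegrableOn (fun s : ℝ => (Kker β t s φ ξ : ℂ) * h s) (Set.Iic t) ∧
          Wgt β t φ ξ ^ (γ - β) * ‖Duh β φ ξ h t‖ ≤
            C * √(∫ s in Set.Iic t, Wgt β s φ ξ ^ (2 * γ - 4 * β) * ‖h s‖ ^ 2) := by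
  obtain ⟨c, hc, C, hC, H⟩ := exists_weighted_Kker_bound β γ hβ
  refine ⟨C * √(1 / (2 * c)), by positivity, fun d φ ξ hne h hh hint t => ?_⟩
  obtain ⟨u, U, b, hb, hu, hbu, hU, hK⟩ := H d φ ξ hne
  have hw := fun s => Wgt_pos (β := β) hne s
  have hsq : (fun s : ℝ => Wgt β s φ ξ ^ (2 * γ - 4 * β) * ‖h s‖ ^ 2) =
      fun s => (Wgt β s φ ξ ^ (γ - 2 * β) * ‖h s‖) ^ 2 := by
    funext s
    rw [mul_pow, ← Real.rpow_natCast (Wgt β s φ ξ ^ _), ← Real.rpow_mul (hw s).le]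
    congr 2
    push_cast
    ring
  rw [hsq] at hint ⊢
  have hKm : Measurable fun s => Kker β t s φ ξ := (Kker_continuous_right hβ t φ ξ).measurable
  have hwt : 0 < Wgt β t φ ξ ^ (γ - β) := Real.rpow_pos_of_pos (hw t) _
  obtain ⟨h1, h2⟩ := integrableOn_mul_norm_of_le
    (k := fun s => Wgt β t φ ξ ^ (γ - β) * Kker β t s φ ξ) hc hC.le hu
    (fun s => hb.le.trans (hbu s)) hU (hKm.const_mul _)
    (fun s => mul_nonneg hwt.le (Kker_pos β t s φ ξ).le)
    ((Wgt_continuous β φ ξ).measurable.pow_const _) (fun s => Real.rpow_nonneg (hw s).le _)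
    hh hint (fun s hs => hK s t hs)
  simp only [mul_assoc (Wgt β t φ ξ ^ (γ - β))] at h1 h2
  have hnorm : ∀ s, ‖(Kker β t s φ ξ : ℂ) * h s‖ = Kker β t s φ ξ * ‖h s‖ := by
    intro s
    rw [norm_mul, Complex.norm_real, Real.norm_of_nonneg (Kker_pos β t s φ ξ).le]
  refine ⟨?_, ?_⟩
  · have h3 : IntegrableOn (fun s => Kker β t s φ ξ * ‖h s‖) (Set.Iic t) :=
      (integrable_const_mul_iff hwt.ne'.isUnit _).1 h1
    refine h3.mono' ?_ (Eventually.of_forall fun s => (hnorm s).le)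
    exact ((Complex.measurable_ofReal.comp hKm).mul hh).aestronglyMeasurable
  · refine le_trans ?_ h2
    rw [integral_const_mul]
    refine mul_le_mul_of_nonneg_left ((norm_integral_le_integral_norm _).trans ?_) hwt.le
    simp only [hnorm, le_refl]

/-- Proposition 2.16, third item: `W^{γ-β} T : L²(W^{2γ-4β}) → C₀(ℝ)` is bounded, with
a constant depending only on `β` and `γ` (not on `φ, ξ`). -/
theorem weighted_duhamel_L2_to_C0 (β γ : ℝ) (hβ : 0 < β) :
    ∃ C : ℝ,
      ∀ (d : ℕ), 1 ≤ d → ∀ φ ξ : EuclideanSpace ℝ (Fin d), (φ, ξ) ≠ (0, 0) →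
        ∀ h : ℝ → ℂ, Measurable h →
          Integrable (fun s : ℝ => Wgt β s φ ξ ^ (2 * γ - 4 * β) * ‖h s‖ ^ 2) →
          (∀ t : ℝ, IntegrableOn (fun s : ℝ => (↑(Kker β t s φ ξ) : ℂ) * h s) (Set.Iic t)) ∧
          Continuous (fun t : ℝ => (↑(Wgt β t φ ξ ^ (γ - β)) : ℂ) * Duh β φ ξ h t) ∧
          Tendsto (fun t : ℝ => (↑(Wgt β t φ ξ ^ (γ - β)) : ℂ) * Duh β φ ξ h t)
            atTop (nhds 0) ∧
          Tendsto (fun t : ℝ => (↑(Wgt β t φ ξ ^ (γ - β)) : ℂ) * Duh β φ ξ h t)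
            atBot (nhds 0) ∧
          ∀ t : ℝ, Wgt β t φ ξ ^ (γ - β) * ‖Duh β φ ξ h t‖
            ≤ C * Real.sqrt (∫ s : ℝ, Wgt β s φ ξ ^ (2 * γ - 4 * β) * ‖h s‖ ^ 2) := by
  obtain ⟨C, hC, H⟩ := exists_weighted_Duh_bound β γ hβ
  refine ⟨C, fun d _ φ ξ hne h hh hint => ?_⟩
  set g : ℝ → ℝ := fun s => Wgt β s φ ξ ^ (2 * γ - 4 * β) * ‖h s‖ ^ 2 with hg
  have hw := fun s => Wgt_pos (β := β) hne s
  have hg0 : ∀ s, 0 ≤ g s := fun s => mul_nonneg (Real.rpow_nonneg (hw s).le _) (sq_nonneg _)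
  have hi := fun t => (H d φ ξ hne h hh hint t).1
  have hnorm : ∀ t, ‖((Wgt β t φ ξ ^ (γ - β) : ℝ) : ℂ) * Duh β φ ξ h t‖ =
      Wgt β t φ ξ ^ (γ - β) * ‖Duh β φ ξ h t‖ := by
    intro t
    rw [norm_mul, Complex.norm_real, Real.norm_of_nonneg (Real.rpow_nonneg (hw t).le _)]
  have hbound := fun t => (H d φ ξ hne h hh hint t).2
  refine ⟨hi, ?_, ?_, ?_, ?_⟩
  · exact (Complex.continuous_ofReal.comp
      ((Wgt_continuous β φ ξ).rpow_const fun t => Or.inl (hw t).ne')).mul (Duh_continuous hβ hi)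
  · rw [Metric.tendsto_nhds]
    intro ε hε
    have htail : Tendsto (fun r : ℝ => C * √(∫ s in Set.Ioi r, g s)) atTop (nhds 0) := by
      simpa using (tendsto_integral_Ioi_zero (f := g) (μ := volume)
        (tendsto_id : Tendsto (id : ℝ → ℝ) atTop atTop)).sqrt.const_mul C
    obtain ⟨r, hr⟩ := (htail.eventually (gt_mem_nhds (half_pos hε))).exists
    have hhead := (tendsto_Wgt_rpow_mul_Kker γ hβ hne r).mul_const ‖Duh β φ ξ h r‖
    rw [zero_mul] at hhead
    filter_upwards [eventually_ge_atTop r, hhead.eventually (gt_mem_nhds (half_pos hε))]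
      with t hrt ht
    have hind : (fun s => Wgt β s φ ξ ^ (2 * γ - 4 * β) * ‖(Set.Ioi r).indicator h s‖ ^ 2) =
        (Set.Ioi r).indicator g := by
      funext s
      simp only [Set.indicator_apply, hg]
      split_ifs <;> simp
    have hgi : Integrable ((Set.Ioi r).indicator g) := hint.indicator measurableSet_Ioi
    have htl := (H d φ ξ hne _ (hh.indicator (measurableSet_Ioi (a := r)))
      (by rw [hind]; exact hgi) t).2
    rw [hind] at htl
    have hmono : ∫ s in Set.Iic t, (Set.Ioi r).indicator g s ≤ ∫ s in Set.Ioi r, g s := by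
      rw [← integral_indicator measurableSet_Ioi]
      exact setIntegral_le_integral hgi
        (Eventually.of_forall fun s => Set.indicator_nonneg (fun s _ => hg0 s) s)
    have htl' := htl.trans (mul_le_mul_of_nonneg_left (Real.sqrt_le_sqrt hmono) hC)
    rw [dist_zero_right, hnorm, Duh_eq_add_indicator hβ hi hrt]
    have hadd := mul_le_mul_of_nonneg_left
      (norm_add_le ((Kker β t r φ ξ : ℂ) * Duh β φ ξ h r) (Duh β φ ξ ((Set.Ioi r).indicator h) t))
      (Real.rpow_nonneg (hw t).le (γ - β))
    rw [norm_mul, Complex.norm_real, Real.norm_of_nonneg (Kker_pos β t r φ ξ).le] at hadd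
    linarith
  · refine squeeze_zero_norm (fun t => (hnorm t).trans_le (hbound t)) ?_
    simpa using (tendsto_integral_Iic_zero (f := g) (μ := volume)
      (tendsto_id : Tendsto (id : ℝ → ℝ) atBot atBot)).sqrt.const_mul C
  · intro t
    refine (hbound t).trans (mul_le_mul_of_nonneg_left (Real.sqrt_le_sqrt ?_) hC)
    exact setIntegral_le_integral hint (Eventually.of_forall hg0)
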